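/- arXiv:1806.02499 — 4 statements merged into one kernel-verified Lean document; each statement's English description precedes it below -/
import Mathlib

section
/- Let n, m be positive integers and let q be a probability mass function on pairs (x,y) ∈ (Fin n → Bool) × (Fin m → Bool) whose support has exactly N elements. Then for every ε > 0 there exists a binary RBM with n+m visible units (identifying the visible vector with the concatenation of x and y) and N+1 hidden units whose visible marginal p satisfies KL(q‖p) < ε; consequently, writing q_X(x) = Σ_y q(x,y), q(y|x) = q(x,y)/q_X(x) whenever q_X(x) > 0, and similarly for p (whose marginal is everywhere positive), the conditional distributions satisfy Σ_{x : q_X(x)>0} q_X(x) · Σ_y q(y|x)·log(q(y|x)/p(y|x)) < ε. -/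
open Finset Real

/-- Encoding of `Bool` as the reals 0 and 1. -/
noncomputable def bval (b : Bool) : ℝ := if b then 1 else 0

/-- Gibbs joint distribution of a binary RBM with `n` visible and `s` hidden units,
`p(x,h) = exp(cᵀx + bᵀh + hᵀWx) / Z`. -/
noncomputable def rbmJoint {n s : ℕ} (W : Matrix (Fin s) (Fin n) ℝ) (b : Fin s → ℝ)
    (c : Fin n → ℝ) (x : Fin n → Bool) (h : Fin s → Bool) : ℝ :=
  Real.exp ((∑ j, c j * bval (x j)) + (∑ i, b i * bval (h i))
      + ∑ i, ∑ j, bval (h i) * W i j * bval (x j)) /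
    ∑ x' : Fin n → Bool, ∑ h' : Fin s → Bool,
      Real.exp ((∑ j, c j * bval (x' j)) + (∑ i, b i * bval (h' i))
        + ∑ i, ∑ j, bval (h' i) * W i j * bval (x' j))

/-- Visible marginal of a binary RBM, `p(x) = Σ_h p(x,h)`. -/
noncomputable def rbmMarginal {n s : ℕ} (W : Matrix (Fin s) (Fin n) ℝ) (b : Fin s → ℝ)
    (c : Fin n → ℝ) (x : Fin n → Bool) : ℝ :=
  ∑ h : Fin s → Bool, rbmJoint W b c x h

/-- Kullback–Leibler divergence of probability mass functions on a finite type,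
`KL(q‖p) = Σ_v q(v)·log(q(v)/p(v))` (terms with `q v = 0` vanish). -/
noncomputable def KLdiv {V : Type*} [Fintype V] (q p : V → ℝ) : ℝ :=
  ∑ v, q v * Real.log (q v / p v)

/-- The unnormalised visible marginal of a binary RBM factorises over the hidden units. -/
theorem sum_hidden_exp {n s : ℕ} (W : Matrix (Fin s) (Fin n) ℝ) (b : Fin s → ℝ)
    (c : Fin n → ℝ) (x : Fin n → Bool) :
    ∑ h : Fin s → Bool, Real.exp ((∑ j, c j * bval (x j)) + (∑ i, b i * bval (h i))
      + ∑ i, ∑ j, bval (h i) * W i j * bval (x j)) =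
    Real.exp (∑ j, c j * bval (x j)) *
      ∏ i, (1 + Real.exp (b i + ∑ j, W i j * bval (x j))) := by
  have factor : ∀ i, (1 + Real.exp (b i + ∑ j, W i j * bval (x j))) =
      ∑ a : Bool, Real.exp (bval a * (b i + ∑ j, W i j * bval (x j))) := by
    intro i
    simp [bval, add_comm]
  rw [Finset.prod_congr rfl fun i _ => factor i, Finset.prod_univ_sum, Fintype.piFinset_univ,
    Finset.mul_sum]
  refine Finset.sum_congr rfl fun h _ => ?_
  rw [← Real.exp_sum, ← Real.exp_add, add_assoc, ← Finset.sum_add_distrib]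
  congr 2
  refine Finset.sum_congr rfl fun i _ => ?_
  rw [mul_add, Finset.mul_sum, mul_comm (b i)]
  simp only [mul_assoc]

theorem rbmMarginal_zero_eq {n s : ℕ} (W : Matrix (Fin s) (Fin n) ℝ) (b : Fin s → ℝ)
    (x : Fin n → Bool) :
    rbmMarginal W b 0 x =
      (∏ i, (1 + Real.exp (b i + ∑ j, W i j * bval (x j)))) /
        ∑ x' : Fin n → Bool, ∏ i, (1 + Real.exp (b i + ∑ j, W i j * bval (x' j))) := by
  simp only [rbmMarginal, rbmJoint, ← Finset.sum_div, sum_hidden_exp]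
  simp

/-- The signed weights `2 v - 1` detect the Hamming distance to the configuration `v`. -/
theorem sum_signed_bval_eq {n : ℕ} (v x : Fin n → Bool) :
    ∑ j, (2 * bval (v j) - 1) * bval (x j) = (∑ j, bval (v j)) - hammingDist v x := by
  rw [hammingDist, Finset.card_filter, Nat.cast_sum, ← Finset.sum_sub_distrib]
  refine Finset.sum_congr rfl fun j _ => ?_
  cases v j <;> cases x j <;> norm_num [bval]

open Filter Topology

theorem tendsto_one_add_mul_exp {w d : ℝ} (hd : 1 ≤ d) :
    Tendsto (fun t : ℝ => 1 + w * Real.exp (t * (1 - 2 * d))) atTop (𝓝 1) := by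
  have h : Tendsto (fun t : ℝ => t * (1 - 2 * d)) atTop atBot :=
    tendsto_id.atTop_mul_const_of_neg (by linarith)
  simpa using ((Real.tendsto_exp_atBot.comp h).const_mul w).const_add 1

theorem one_le_hammingDist {n : ℕ} {v x : Fin n → Bool} (h : v ≠ x) :
    (1 : ℝ) ≤ hammingDist v x := by
  exact_mod_cast hammingDist_pos.2 h

/-- Rescaled by `exp (-t)`, a product of bumps at distinct configurations converges to the
weighted sum of the corresponding point masses. -/
theorem tendsto_prod_bumps {n N : ℕ} {v : Fin N → Fin n → Bool} (hv : Function.Injective v)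
    (w : Fin N → ℝ) (x : Fin n → Bool) :
    Tendsto (fun t : ℝ => Real.exp (-t) *
        ∏ k, (1 + w k * Real.exp (t * (1 - 2 * hammingDist (v k) x))))
      atTop (𝓝 (∑ k, if v k = x then w k else 0)) := by
  by_cases hx : ∃ k, v k = x
  · obtain ⟨k, rfl⟩ := hx
    have hsum : (∑ i, if v i = v k then w i else 0) = w k := by
      simp [hv.eq_iff]
    have hpeak : Tendsto (fun t : ℝ => Real.exp (-t) + w k) atTop (𝓝 (0 + w k)) :=
      Real.tendsto_exp_neg_atTop_nhds_zero.add_const _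
    have hrest := tendsto_finsetProd (Finset.univ.erase k) fun i hi =>
      tendsto_one_add_mul_exp (w := w i)
        (one_le_hammingDist (hv.ne (Finset.ne_of_mem_erase hi)))
    have h := hpeak.mul hrest
    rw [hsum]
    simp only [Finset.prod_const_one, zero_add, mul_one] at h
    refine h.congr fun t => ?_
    rw [← Finset.mul_prod_erase Finset.univ _ (Finset.mem_univ k), ← mul_assoc]
    congr 1
    simp only [hammingDist_self, Nat.cast_zero, mul_zero, sub_zero, mul_one]
    rw [mul_add, mul_one, mul_left_comm, ← Real.exp_add]
    simp
  · push Not at hx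
    have h := Real.tendsto_exp_neg_atTop_nhds_zero.mul
      (tendsto_finsetProd Finset.univ fun i _ =>
        tendsto_one_add_mul_exp (w := w i) (one_le_hammingDist (hx i)))
    simpa [hx] using h

/-- Every pmf whose support has `N` elements is a pointwise limit of visible marginals of binary
RBMs with `N + 1` hidden units. -/
theorem exists_tendsto_rbmMarginal {n N : ℕ} (q : (Fin n → Bool) → ℝ) (hq0 : ∀ x, 0 ≤ q x)
    (hq1 : ∑ x, q x = 1) (hsupp : (Finset.univ.filter fun x => q x ≠ 0).card = N) :
    ∃ (W : ℝ → Matrix (Fin (N + 1)) (Fin n) ℝ) (b : ℝ → Fin (N + 1) → ℝ),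
      ∀ x, Tendsto (fun t => rbmMarginal (W t) (b t) 0 x) atTop (𝓝 (q x)) := by
  let e := (Finset.univ.filter fun x => q x ≠ 0).equivFinOfCardEq hsupp
  let v : Fin N → Fin n → Bool := fun k => (e.symm k : Fin n → Bool)
  have hv : Function.Injective v := Subtype.val_injective.comp e.symm.injective
  have hpos : ∀ k, 0 < q (v k) := fun k =>
    (hq0 _).lt_of_ne' (Finset.mem_filter.1 (e.symm k).2).2
  have hqsum : ∀ x, (∑ k, if v k = x then q (v k) else 0) = q x := by
    intro x
    by_cases hx : q x = 0
    · rw [hx]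
      refine Finset.sum_eq_zero fun k _ => ?_
      split_ifs with h
      · rw [h, hx]
      · rfl
    · have hk : v (e ⟨x, by simpa using hx⟩) = x := by simp [v]
      rw [← hk]
      simp [hv.eq_iff]
  let W : ℝ → Matrix (Fin (N + 1)) (Fin n) ℝ := fun t =>
    Fin.snoc (α := fun _ => Fin n → ℝ) (fun k j => 2 * t * (2 * bval (v k j) - 1)) 0
  let b : ℝ → Fin (N + 1) → ℝ := fun t =>
    Fin.snoc (α := fun _ => ℝ) (fun k => Real.log (q (v k)) + t - 2 * t * ∑ j, bval (v k j)) (-t)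
  let F : ℝ → (Fin n → Bool) → ℝ := fun t x =>
    ∏ i, (1 + Real.exp (b t i + ∑ j, W t i j * bval (x j)))
  have hF : ∀ t x, F t x =
      (∏ k, (1 + q (v k) * Real.exp (t * (1 - 2 * hammingDist (v k) x)))) *
        (1 + Real.exp (-t)) := by
    intro t x
    simp only [F, Fin.prod_univ_castSucc, W, b, Fin.snoc_castSucc, Fin.snoc_last]
    congr 1
    · refine Finset.prod_congr rfl fun k _ => ?_
      have hsum : ∑ j, 2 * t * (2 * bval (v k j) - 1) * bval (x j) =
          2 * t * ((∑ j, bval (v k j)) - hammingDist (v k) x) := by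
        rw [← sum_signed_bval_eq, Finset.mul_sum]
        simp only [mul_assoc]
      rw [hsum, ← Real.exp_log (hpos k), ← Real.exp_add, Real.log_exp]
      ring_nf
    · simp
  have hlim : ∀ x, Tendsto (fun t => Real.exp (-t) * F t x) atTop (𝓝 (q x)) := by
    intro x
    have h := (tendsto_prod_bumps hv (fun k => q (v k)) x).mul
      (Real.tendsto_exp_neg_atTop_nhds_zero.const_add 1)
    rw [hqsum, add_zero, mul_one] at h
    refine h.congr fun t => ?_
    rw [hF, mul_assoc]
  refine ⟨W, b, fun x => ?_⟩
  have h := (hlim x).div (tendsto_finsetSum Finset.univ fun x' _ => hlim x') (by simp [hq1])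
  rw [hq1, div_one] at h
  refine h.congr fun t => ?_
  simp only [Pi.div_apply]
  rw [rbmMarginal_zero_eq, ← Finset.mul_sum, mul_div_mul_left _ _ (Real.exp_pos _).ne']

theorem tendsto_log_div_nhds_zero {ι : Type*} {l : Filter ι} {a : ℝ} {f : ι → ℝ} (ha : a ≠ 0)
    (hf : Tendsto f l (𝓝 a)) : Tendsto (fun t => Real.log (a / f t)) l (𝓝 0) := by
  have h := ((tendsto_const_nhds (x := a)).div hf ha).log (by simp [ha])
  simpa [ha] using h

theorem tendsto_KLdiv_nhds_zero {ι V : Type*} [Fintype V] {l : Filter ι} {q : V → ℝ}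
    {p : ι → V → ℝ} (hp : ∀ v, Tendsto (fun t => p t v) l (𝓝 (q v))) :
    Tendsto (fun t => KLdiv q (p t)) l (𝓝 0) := by
  have h : ∀ v ∈ (Finset.univ : Finset V),
      Tendsto (fun t => q v * Real.log (q v / p t v)) l (𝓝 0) := by
    intro v _
    by_cases hv : q v = 0
    · simp [hv, tendsto_const_nhds]
    · simpa using (tendsto_log_div_nhds_zero hv (hp v)).const_mul (q v)
  simpa [KLdiv] using tendsto_finsetSum Finset.univ h

/-- A pmf `q` on pairs `(x,y)` with support of size `N` can be approximated arbitrarily well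
in KL divergence by the visible marginal `p` of a binary RBM with `n + m` visible units
(identifying the visible vector with the concatenation of `x` and `y`) and `N + 1` hidden
units; consequently the expected KL divergence between the conditional distributions
`q(·|x)` and `p(·|x)` is also smaller than `ε`. -/
theorem rbm_conditional_universal_approximation {n m N : ℕ} (hn : 0 < n) (hm : 0 < m)
    (q : ((Fin n → Bool) × (Fin m → Bool)) → ℝ)
    (hq0 : ∀ v, 0 ≤ q v) (hq1 : ∑ v, q v = 1)
    (hsupp : (Finset.univ.filter
        (fun v : (Fin n → Bool) × (Fin m → Bool) => q v ≠ 0)).card = N)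
    (ε : ℝ) (hε : 0 < ε) :
    ∃ (W : Matrix (Fin (N + 1)) (Fin (n + m)) ℝ) (b : Fin (N + 1) → ℝ) (c : Fin (n + m) → ℝ),
      let p : ((Fin n → Bool) × (Fin m → Bool)) → ℝ :=
        fun v => rbmMarginal W b c (Fin.append v.1 v.2)
      KLdiv q p < ε ∧
      ∑ x ∈ Finset.univ.filter (fun x : Fin n → Bool => 0 < ∑ y : Fin m → Bool, q (x, y)),
        (∑ y : Fin m → Bool, q (x, y)) *
          ∑ y : Fin m → Bool,
            (q (x, y) / ∑ y' : Fin m → Bool, q (x, y')) *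
              Real.log ((q (x, y) / ∑ y' : Fin m → Bool, q (x, y')) /
                (p (x, y) / ∑ y' : Fin m → Bool, p (x, y'))) < ε := by
  have hmass : ∀ v : (Fin n → Bool) × (Fin m → Bool), q v = q ((Fin.appendEquiv n m).symm
      (Fin.append v.1 v.2)) := fun v =>
    congrArg q ((Fin.appendEquiv n m).symm_apply_apply v).symm
  obtain ⟨W, b, hWb⟩ := exists_tendsto_rbmMarginal
    (fun z => q ((Fin.appendEquiv n m).symm z)) (fun z => hq0 _)
    (by rw [Equiv.sum_comp (Fin.appendEquiv n m).symm q, hq1])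
    (N := N) (by
      rw [← hsupp]
      exact Finset.card_equiv (Fin.appendEquiv n m).symm (by simp))
  let p : ℝ → (Fin n → Bool) × (Fin m → Bool) → ℝ := fun t v =>
    rbmMarginal (W t) (b t) 0 (Fin.append v.1 v.2)
  have hp : ∀ v, Tendsto (fun t => p t v) atTop (𝓝 (q v)) := by
    intro v
    rw [hmass v]
    exact hWb _
  have hKL : Tendsto (fun t => KLdiv q (p t)) atTop (𝓝 0) := tendsto_KLdiv_nhds_zero hp
  have hcond : Tendsto (fun t =>
      ∑ x ∈ Finset.univ.filter (fun x : Fin n → Bool => 0 < ∑ y : Fin m → Bool, q (x, y)),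
        (∑ y : Fin m → Bool, q (x, y)) *
          ∑ y : Fin m → Bool,
            (q (x, y) / ∑ y' : Fin m → Bool, q (x, y')) *
              Real.log ((q (x, y) / ∑ y' : Fin m → Bool, q (x, y')) /
                (p t (x, y) / ∑ y' : Fin m → Bool, p t (x, y')))) atTop (𝓝 0) := by
    have h := tendsto_finsetSum
      (Finset.univ.filter (fun x : Fin n → Bool => 0 < ∑ y : Fin m → Bool, q (x, y)))
      fun x hx => (tendsto_KLdiv_nhds_zero fun y =>
        (hp (x, y)).div (tendsto_finsetSum Finset.univ fun y' _ => hp (x, y'))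
          (Finset.mem_filter.1 hx).2.ne').const_mul (∑ y : Fin m → Bool, q (x, y))
    simp only [mul_zero, Finset.sum_const_zero] at h
    exact h
  obtain ⟨t, htKL, htcond⟩ :=
    ((hKL.eventually_lt_const hε).and (hcond.eventually_lt_const hε)).exists
  exact ⟨W t, b t, 0, htKL, htcond⟩
end

section
/- Any probability mass function q on Fin n → Bool whose support has exactly r elements can be approximated arbitrarily well in Kullback–Leibler divergence by the visible marginal of a binary RBM with n visible units and r+1 hidden units: for every ε > 0 there exist parameters W, b, c such that the visible marginal p of the corresponding RBM satisfies KL(q‖p) < ε. -/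
open Finset Real

open Filter Topology

/-- Unnormalized visible marginal of an RBM, with the hidden units summed out. -/
noncomputable def rbmWeight {n s : ℕ} (W : Matrix (Fin s) (Fin n) ℝ) (b : Fin s → ℝ)
    (c : Fin n → ℝ) (x : Fin n → Bool) : ℝ :=
  Real.exp (∑ j, c j * bval (x j)) * ∏ i, (1 + Real.exp (b i + ∑ j, W i j * bval (x j)))

theorem sum_hidden_exp_eq_rbmWeight {n s : ℕ} (W : Matrix (Fin s) (Fin n) ℝ) (b : Fin s → ℝ)
    (c : Fin n → ℝ) (x : Fin n → Bool) :
    ∑ h : Fin s → Bool, Real.exp ((∑ j, c j * bval (x j)) + (∑ i, b i * bval (h i))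
      + ∑ i, ∑ j, bval (h i) * W i j * bval (x j)) = rbmWeight W b c x := by
  have hprod : ∏ i, (1 + Real.exp (b i + ∑ j, W i j * bval (x j))) =
      ∑ h : Fin s → Bool, ∏ i, Real.exp (bval (h i) * (b i + ∑ j, W i j * bval (x j))) := by
    have h := Finset.prod_univ_sum (fun _ : Fin s => (Finset.univ : Finset Bool))
      fun i a => Real.exp (bval a * (b i + ∑ j, W i j * bval (x j)))
    rw [Fintype.piFinset_univ] at h
    rw [← h]
    simp [bval, add_comm]
  rw [rbmWeight, hprod, Finset.mul_sum]
  refine Finset.sum_congr rfl fun h _ => ?_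
  rw [← Real.exp_sum, ← Real.exp_add, add_assoc, ← Finset.sum_add_distrib]
  congr 2
  refine Finset.sum_congr rfl fun i _ => ?_
  simp only [mul_add, Finset.mul_sum, mul_assoc, mul_comm (b i)]

theorem rbmMarginal_eq_rbmWeight_div {n s : ℕ} (W : Matrix (Fin s) (Fin n) ℝ) (b : Fin s → ℝ)
    (c : Fin n → ℝ) (x : Fin n → Bool) :
    rbmMarginal W b c x = rbmWeight W b c x / ∑ x', rbmWeight W b c x' := by
  simp only [rbmMarginal, rbmJoint, ← Finset.sum_div, sum_hidden_exp_eq_rbmWeight]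

/-- The divergence `KL(q‖p)` tends to `0` when `p` tends to `q` pointwise. -/
theorem tendsto_KLdiv_zero {V ι : Type*} [Fintype V] {l : Filter ι} {q : V → ℝ}
    {p : ι → V → ℝ} (hp : ∀ v, Tendsto (fun i => p i v) l (𝓝 (q v))) :
    Tendsto (fun i => KLdiv q (p i)) l (𝓝 0) := by
  have hterm : ∀ v ∈ Finset.univ,
      Tendsto (fun i => q v * Real.log (q v / p i v)) l (𝓝 0) := by
    intro v _
    by_cases hv : q v = 0
    · simp [hv, tendsto_const_nhds]
    · have hdiv : Tendsto (fun i => q v / p i v) l (𝓝 1) := by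
        rw [← div_self hv]
        exact tendsto_const_nhds.div (hp v) hv
      simpa using (hdiv.log one_ne_zero).const_mul (q v)
  simpa [KLdiv] using tendsto_finsetSum Finset.univ hterm

/-- A bias and a weight vector whose affine form at `x` is `l - a * hammingDist v x`. -/
theorem affine_eq_sub_mul_hammingDist {n : ℕ} (v x : Fin n → Bool) (a l : ℝ) :
    (l - a * ∑ j, bval (v j)) + ∑ j, a * (2 * bval (v j) - 1) * bval (x j) =
      l - a * hammingDist v x := by
  have hdist : (hammingDist v x : ℝ) =
      ∑ j, (bval (v j) - (2 * bval (v j) - 1) * bval (x j)) := by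
    rw [hammingDist, Finset.card_filter, Nat.cast_sum]
    refine Finset.sum_congr rfl fun j _ => ?_
    cases v j <;> cases x j <;> norm_num [bval]
  rw [hdist, Finset.sum_sub_distrib, mul_sub]
  simp only [mul_assoc, ← Finset.mul_sum]
  ring

/-- A product of bumps centred at the points of the cube, of heights proportional to `q`. -/
noncomputable def bumpProduct {n : ℕ} (q : (Fin n → Bool) → ℝ) (t : ℝ) (x : Fin n → Bool) : ℝ :=
  ∏ v, (1 + q v * Real.exp (t - 2 * t * hammingDist v x))

theorem tendsto_exp_neg_mul_bumpProduct {n : ℕ} (q : (Fin n → Bool) → ℝ) (x : Fin n → Bool) :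
    Tendsto (fun t => Real.exp (-t) * bumpProduct q t x) atTop (𝓝 (q x)) := by
  have hexp : Tendsto (fun t : ℝ => Real.exp (-t)) atTop (𝓝 0) :=
    Real.tendsto_exp_neg_atTop_nhds_zero
  have hself : Tendsto
      (fun t => Real.exp (-t) * (1 + q x * Real.exp (t - 2 * t * hammingDist x x)))
      atTop (𝓝 (q x)) := by
    have heq : ∀ t : ℝ, Real.exp (-t) * (1 + q x * Real.exp (t - 2 * t * hammingDist x x)) =
        Real.exp (-t) + q x := by
      intro t
      have hinv : Real.exp (-t) * Real.exp t = 1 := by rw [← Real.exp_add]; simp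
      simp only [hammingDist_self, Nat.cast_zero, mul_zero, sub_zero]
      linear_combination q x * hinv
    simp only [heq]
    simpa using hexp.add_const (q x)
  have hother : ∀ v ∈ Finset.univ.erase x,
      Tendsto (fun t => 1 + q v * Real.exp (t - 2 * t * hammingDist v x)) atTop (𝓝 1) := by
    intro v hv
    have hd : (1 : ℝ) ≤ hammingDist v x := by
      exact_mod_cast hammingDist_pos.2 (Finset.ne_of_mem_erase hv)
    have hle : Tendsto (fun t => Real.exp (t - 2 * t * hammingDist v x)) atTop (𝓝 0) := by
      refine squeeze_zero' (Eventually.of_forall fun t => (Real.exp_pos _).le) ?_ hexp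
      filter_upwards [eventually_ge_atTop 0] with t ht
      exact Real.exp_le_exp.2 (by nlinarith)
    simpa using (hle.const_mul (q v)).const_add 1
  have hmul := hself.mul (tendsto_finsetProd _ hother)
  simp only [Finset.prod_const_one, mul_one] at hmul
  refine hmul.congr fun t => ?_
  rw [bumpProduct, ← Finset.mul_prod_erase _ _ (Finset.mem_univ x), mul_assoc]

theorem tendsto_normalized_bumpProduct {n : ℕ} {q : (Fin n → Bool) → ℝ} (hq : ∑ x, q x = 1)
    (x : Fin n → Bool) :
    Tendsto (fun t => bumpProduct q t x / ∑ x', bumpProduct q t x') atTop (𝓝 (q x)) := by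
  have hsum := tendsto_finsetSum Finset.univ
    fun x' _ => tendsto_exp_neg_mul_bumpProduct q x'
  rw [hq] at hsum
  have hdiv := (tendsto_exp_neg_mul_bumpProduct q x).div hsum one_ne_zero
  rw [div_one] at hdiv
  refine hdiv.congr fun t => ?_
  rw [Pi.div_apply, ← Finset.mul_sum, mul_div_mul_left _ _ (Real.exp_pos _).ne']

/-- One hidden unit per support point realizes `bumpProduct`; the remaining unit is inert. -/
theorem exists_rbmWeight_eq_bumpProduct {n r : ℕ} {q : (Fin n → Bool) → ℝ} (hq : ∀ x, 0 ≤ q x)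
    (hsupp : (Finset.univ.filter (fun x : Fin n → Bool => q x ≠ 0)).card = r) (t : ℝ) :
    ∃ (W : Matrix (Fin (r + 1)) (Fin n) ℝ) (b : Fin (r + 1) → ℝ) (c : Fin n → ℝ),
      ∀ x, rbmWeight W b c x = 2 * bumpProduct q t x := by
  let e := Finset.equivFinOfCardEq hsupp
  let v : Fin r → Fin n → Bool := fun i => (e.symm i : Fin n → Bool)
  refine ⟨Fin.cons (fun _ => 0) fun i j => 2 * t * (2 * bval (v i j) - 1),
    Fin.cons 0 fun i => (Real.log (q (v i)) + t) - 2 * t * ∑ j, bval (v i j), 0, fun x => ?_⟩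
  have hfactor : ∀ i, Real.exp (Real.log (q (v i)) + t - 2 * t * hammingDist (v i) x) =
      q (v i) * Real.exp (t - 2 * t * hammingDist (v i) x) := by
    intro i
    have hne : q (v i) ≠ 0 := (Finset.mem_filter.1 (e.symm i).2).2
    rw [add_sub_assoc, Real.exp_add, Real.exp_log ((hq _).lt_of_ne' hne)]
  have hprod : ∏ i, (1 + q (v i) * Real.exp (t - 2 * t * hammingDist (v i) x)) =
      bumpProduct q t x := by
    rw [e.symm.prod_comp fun w => 1 + q w * Real.exp (t - 2 * t * hammingDist (w : Fin n → Bool) x),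
      Finset.prod_coe_sort _ fun w => 1 + q w * Real.exp (t - 2 * t * hammingDist w x), bumpProduct]
    refine Finset.prod_subset (Finset.subset_univ _) fun w _ hw => ?_
    have hzero : q w = 0 := by simpa using hw
    simp [hzero]
  simp only [rbmWeight, Fin.prod_univ_succ, Fin.cons_zero, Fin.cons_succ,
    affine_eq_sub_mul_hammingDist, hfactor, hprod]
  norm_num

/-- Le Roux–Bengio: any pmf on `Fin n → Bool` whose support has exactly `r` elements can be
approximated arbitrarily well in KL divergence by the visible marginal of a binary RBM with
`n` visible and `r + 1` hidden units. -/
theorem rbm_universal_approximation {n r : ℕ}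
    (q : (Fin n → Bool) → ℝ) (hq0 : ∀ x, 0 ≤ q x) (hq1 : ∑ x, q x = 1)
    (hsupp : (Finset.univ.filter (fun x : Fin n → Bool => q x ≠ 0)).card = r)
    (ε : ℝ) (hε : 0 < ε) :
    ∃ (W : Matrix (Fin (r + 1)) (Fin n) ℝ) (b : Fin (r + 1) → ℝ) (c : Fin n → ℝ),
      KLdiv q (rbmMarginal W b c) < ε := by
  obtain ⟨t, ht⟩ := ((tendsto_KLdiv_zero fun x =>
    tendsto_normalized_bumpProduct hq1 x).eventually_lt_const hε).exists
  obtain ⟨W, b, c, hW⟩ := exists_rbmWeight_eq_bumpProduct hq0 hsupp t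
  refine ⟨W, b, c, ?_⟩
  suffices h : rbmMarginal W b c = fun x => bumpProduct q t x / ∑ x', bumpProduct q t x' by
    rwa [h]
  funext x
  simp only [rbmMarginal_eq_rbmWeight_div, hW, ← Finset.mul_sum,
    mul_div_mul_left _ _ (two_ne_zero' ℝ)]
end

section
/- Let F be a finite index set, α, v : F → ℝ, and d ∈ ℝ. Assume d ≠ 0 and d + Σ_{j∈S} v_j ≠ 0 for every nonempty subset S ⊆ F. Then ∫_{0}^{1} e^{d y} · ∏_{j∈F} (1 + e^{α_j + v_j y}) dy = (e^{d} − 1)/d + Σ_{∅≠S⊆F} e^{Σ_{j∈S} α_j} · (e^{d + Σ_{j∈S} v_j} − 1)/(d + Σ_{j∈S} v_j). -/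
open Finset Real

/-- The integral over `[0,1]` of `y ↦ e^{c y}` for `c ≠ 0`. -/
theorem integral_unit_interval_exp_mul {c : ℝ} (hc : c ≠ 0) :
    ∫ y in (0 : ℝ)..1, Real.exp (c * y) = (Real.exp c - 1) / c := by
  rw [intervalIntegral.integral_comp_mul_left (fun y => Real.exp y) hc, integral_exp]
  simp [div_eq_inv_mul]

theorem exp_mul_prod_one_add_exp {ι : Type*} (F : Finset ι) (α v : ι → ℝ) (d y : ℝ) :
    Real.exp (d * y) * ∏ j ∈ F, (1 + Real.exp (α j + v j * y))
      = ∑ S ∈ F.powerset, Real.exp (∑ j ∈ S, α j) * Real.exp ((d + ∑ j ∈ S, v j) * y) := by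
  rw [Finset.prod_one_add, Finset.mul_sum]
  refine Finset.sum_congr rfl fun S _ => ?_
  rw [← Real.exp_sum, ← Real.exp_add, ← Real.exp_add, Finset.sum_add_distrib, ← Finset.sum_mul]
  ring_nf

/-- Normalizing integral on `[0,1]` of the RBM conditional density:
`∫_0^1 e^{dy} ∏_{j∈F} (1 + e^{α_j + v_j y}) dy
  = (e^d − 1)/d + Σ_{∅≠S⊆F} e^{Σ_{j∈S} α_j} (e^{d + Σ_{j∈S} v_j} − 1)/(d + Σ_{j∈S} v_j)`. -/
theorem integral_unit_interval_exp_prod {ι : Type*} [DecidableEq ι]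
    (F : Finset ι) (α v : ι → ℝ) (d : ℝ) (hd : d ≠ 0)
    (hdv : ∀ S ∈ F.powerset, S.Nonempty → d + ∑ j ∈ S, v j ≠ 0) :
    ∫ y in (0 : ℝ)..1, Real.exp (d * y) * ∏ j ∈ F, (1 + Real.exp (α j + v j * y))
      = (Real.exp d - 1) / d
        + ∑ S ∈ F.powerset.filter (fun S => S.Nonempty),
            Real.exp (∑ j ∈ S, α j) *
              (Real.exp (d + ∑ j ∈ S, v j) - 1) / (d + ∑ j ∈ S, v j) := by
  have hne : ∀ S ∈ F.powerset, d + ∑ j ∈ S, v j ≠ 0 := by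
    intro S hS
    rcases S.eq_empty_or_nonempty with rfl | h
    · simpa using hd
    · exact hdv S hS h
  have hfilter : F.powerset.filter (fun S => S.Nonempty) = F.powerset.erase ∅ := by
    ext S
    simp [Finset.nonempty_iff_ne_empty, and_comm]
  simp_rw [exp_mul_prod_one_add_exp]
  rw [intervalIntegral.integral_finsetSum fun S _ =>
      Continuous.intervalIntegrable (by fun_prop) _ _,
    hfilter, ← Finset.add_sum_erase _ _ (Finset.empty_mem_powerset F)]
  congr 1
  · simp [integral_unit_interval_exp_mul hd]
  · refine Finset.sum_congr rfl fun S hS => ?_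
    rw [intervalIntegral.integral_const_mul,
      integral_unit_interval_exp_mul (hne S (Finset.mem_of_mem_erase hS)), mul_div_assoc]
end

section
/- Let X and H be finite nonempty types and E : ℝ → X × H → ℝ such that for each (x,h) the map θ ↦ E θ (x,h) is differentiable at θ₀ with derivative D(x,h). Define the visible marginal p_θ(x) = (Σ_h e^{−E θ (x,h)}) / (Σ_{x',h'} e^{−E θ (x',h')}), the Gibbs conditional weights w_x(h) = e^{−E θ₀ (x,h)} / Σ_{h'} e^{−E θ₀ (x,h')}, and the free-energy derivative G(x) = Σ_h w_x(h)·D(x,h). Then for every x₀ ∈ X, the map θ ↦ log p_θ(x₀) is differentiable at θ₀ with derivative Σ_{x∈X} p_{θ₀}(x)·G(x) − G(x₀); that is, ∂ log p(x₀)/∂Λ = Σ_x p(x)·∂F(x)/∂Λ − ∂F(x₀)/∂Λ where F_θ(x) = −log Σ_h e^{−E θ (x,h)} is the free energy. -/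
open Finset Real

/-- The free energy `-log ∑ i, exp (-f i)` of a finite family of energies has as derivative the
Gibbs average of the derivatives of the energies. -/
theorem hasDerivAt_neg_log_sum_exp_neg {ι : Type*} [Fintype ι] [Nonempty ι]
    {f : ℝ → ι → ℝ} {f' : ι → ℝ} {t : ℝ} (hf : ∀ i, HasDerivAt (fun s => f s i) (f' i) t) :
    HasDerivAt (fun s => -Real.log (∑ i, Real.exp (-(f s i))))
      (∑ i, (Real.exp (-(f t i)) / ∑ j, Real.exp (-(f t j))) * f' i) t := by
  have hpos : 0 < ∑ i, Real.exp (-(f t i)) :=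
    Finset.sum_pos (fun i _ => Real.exp_pos _) Finset.univ_nonempty
  have hsum : HasDerivAt (fun s => ∑ i, Real.exp (-(f s i)))
      (∑ i, Real.exp (-(f t i)) * -f' i) t :=
    HasDerivAt.fun_sum fun i _ => (hf i).fun_neg.exp
  refine (hsum.log hpos.ne').fun_neg.congr_deriv ?_
  rw [← neg_div, ← Finset.sum_neg_distrib, Finset.sum_div]
  exact Finset.sum_congr rfl fun i _ => by ring

/-- Gradient of the log visible marginal of an energy-based model:
`∂ log p(x₀)/∂θ = Σ_x p(x)·∂F(x)/∂θ − ∂F(x₀)/∂θ`, where `F` is the free energy and the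
free energy derivative is `G x = Σ_h w_x(h)·D(x,h)` with Gibbs conditional weights `w_x`. -/
theorem hasDerivAt_log_marginal {X H : Type*} [Fintype X] [Fintype H]
    [Nonempty X] [Nonempty H]
    (E : ℝ → X × H → ℝ) (θ₀ : ℝ) (D : X × H → ℝ)
    (hE : ∀ p : X × H, HasDerivAt (fun θ => E θ p) (D p) θ₀) (x₀ : X) :
    HasDerivAt
      (fun θ => Real.log ((∑ h : H, Real.exp (-(E θ (x₀, h)))) /
        (∑ x : X, ∑ h : H, Real.exp (-(E θ (x, h))))))
      ((∑ x : X,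
          ((∑ h : H, Real.exp (-(E θ₀ (x, h)))) /
              (∑ x' : X, ∑ h' : H, Real.exp (-(E θ₀ (x', h'))))) *
            (∑ h : H, (Real.exp (-(E θ₀ (x, h))) / ∑ h' : H, Real.exp (-(E θ₀ (x, h')))) *
              D (x, h)))
        - ∑ h : H, (Real.exp (-(E θ₀ (x₀, h))) / ∑ h' : H, Real.exp (-(E θ₀ (x₀, h')))) *
            D (x₀, h)) θ₀ := by
  have hpos (θ : ℝ) (x : X) : 0 < ∑ h : H, Real.exp (-(E θ (x, h))) :=
    Finset.sum_pos (fun h _ => Real.exp_pos _) Finset.univ_nonempty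
  have hZ (θ : ℝ) : 0 < ∑ x : X, ∑ h : H, Real.exp (-(E θ (x, h))) :=
    Finset.sum_pos (fun x _ => hpos θ x) Finset.univ_nonempty
  have hF (x : X) := hasDerivAt_neg_log_sum_exp_neg (f := fun θ h => E θ (x, h))
    fun h => hE (x, h)
  have hlogZ := hasDerivAt_neg_log_sum_exp_neg
    (f := fun θ x => -Real.log (∑ h : H, Real.exp (-(E θ (x, h))))) hF
  simp only [neg_neg, Real.exp_log (hpos _ _)] at hlogZ
  refine (hlogZ.sub (hF x₀)).congr_of_eventuallyEq ?_
  filter_upwards with θ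
  rw [Pi.sub_apply, Real.log_div (hpos θ x₀).ne' (hZ θ).ne']
  ring
end
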